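/- Set θⱼ = α₀ + α₁ + … + α_{j−1} (with θ₀ = 0) and μⱼ = (cos θⱼ, sin θⱼ) ∈ ℝ². Then for u ∈ ℝ^m one has M(α)·u = 0 if and only if there exists a ∈ ℝ² with uⱼ = ⟨a, μⱼ⟩ for all j; consequently the kernel of M(α) is exactly 2-dimensional and consists of the variations of support numbers induced by parallel translations of the polygon. -/

import Mathlib

/-- The Hessian of the area of a convex `m`-gon with fixed edge normal directions,
as a function of the support numbers: `M_{jj} = −(cot α_{j−1} + cot αⱼ)`,
`M_{j,j+1} = M_{j+1,j} = 1/sin αⱼ`, and `0` elsewhere. -/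
noncomputable def polygonHessian (m : ℕ) [NeZero m] (α : ZMod m → ℝ) :
    Matrix (ZMod m) (ZMod m) ℝ :=
  Matrix.of fun j k =>
    if k = j then -(Real.cot (α (j - 1)) + Real.cot (α j))
    else if k = j + 1 then 1 / Real.sin (α j)
    else if j = k + 1 then 1 / Real.sin (α k)
    else 0

section PolygonHessian

/-- The row of the polygon Hessian applied to a vector is a three-term recurrence. -/
theorem polygonHessian_mulVec_apply (m : ℕ) [NeZero m] (hm : 3 ≤ m)
    (α : ZMod m → ℝ) (u : ZMod m → ℝ) (j : ZMod m) :
    (polygonHessian m α).mulVec u j =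
      -(Real.cot (α (j - 1)) + Real.cot (α j)) * u j + 1 / Real.sin (α j) * u (j + 1) +
        1 / Real.sin (α (j - 1)) * u (j - 1) := by
  have h1 : (1 : ZMod m) ≠ 0 := by
    have : Fact (1 < m) := ⟨by omega⟩
    exact one_ne_zero
  have h2 : (2 : ZMod m) ≠ 0 := by
    intro h
    have h' : ((2 : ℕ) : ZMod m) = 0 := by exact_mod_cast h
    rw [ZMod.natCast_eq_zero_iff] at h'
    have := Nat.le_of_dvd (by norm_num) h'
    omega
  have a1 : j + 1 ≠ j := by simpa using h1
  have a2 : j - 1 ≠ j := by simpa using h1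
  have a3 : j - 1 ≠ j + 1 := by
    intro h
    apply h2
    linear_combination -h
  have key : ∀ k, polygonHessian m α j k * u k =
      (if k = j then -(Real.cot (α (j - 1)) + Real.cot (α j)) * u j else 0) +
      (if k = j + 1 then 1 / Real.sin (α j) * u (j + 1) else 0) +
      (if k = j - 1 then 1 / Real.sin (α (j - 1)) * u (j - 1) else 0) := by
    intro k
    have e : j = k + 1 ↔ k = j - 1 := by
      rw [eq_sub_iff_add_eq, eq_comm]
    simp only [polygonHessian, Matrix.of_apply, e]
    by_cases k1 : k = j
    · subst k1
      simp [a1.symm, a2.symm]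
    by_cases k2 : k = j + 1
    · subst k2
      simp [h1, a3.symm]
    by_cases k3 : k = j - 1
    · subst k3
      simp [h1, a3]
    · simp [k1, k2, k3]
  simp only [Matrix.mulVec, dotProduct, key, Finset.sum_add_distrib, Finset.sum_ite_eq',
    Finset.mem_univ, if_true]

/-- Summing over representatives is summing over `ZMod m`. -/
theorem ZMod.sum_range_natCast (m : ℕ) [NeZero m] (α : ZMod m → ℝ) :
    ∑ i ∈ Finset.range m, α (i : ZMod m) = ∑ j, α j := by
  refine Finset.sum_bij (fun i _ => (i : ZMod m)) (by simp) ?_ ?_ (by simp)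
  · intro a ha b hb hab
    have := congrArg ZMod.val hab
    simpa [ZMod.val_natCast, Nat.mod_eq_of_lt (Finset.mem_range.1 ha),
      Nat.mod_eq_of_lt (Finset.mem_range.1 hb)] using this
  · intro b _
    exact ⟨b.val, by simpa using ZMod.val_lt b, by simp⟩

/-- The angle of the `j`-th edge normal. -/
noncomputable def normalAngle (m : ℕ) (α : ZMod m → ℝ) (j : ZMod m) : ℝ :=
  ∑ i ∈ Finset.range j.val, α (i : ZMod m)

theorem normalAngle_add_one (m : ℕ) [NeZero m] (α : ZMod m → ℝ)
    (hsum : ∑ j, α j = 2 * Real.pi) (j : ZMod m) :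
    normalAngle m α (j + 1) = normalAngle m α j + α j ∨
      normalAngle m α (j + 1) = normalAngle m α j + α j - 2 * Real.pi := by
  have hs : ∑ i ∈ Finset.range (j.val + 1), α (i : ZMod m) = normalAngle m α j + α j := by
    rw [Finset.sum_range_succ, ZMod.natCast_zmod_val, normalAngle]
  have hj : j + 1 = ((j.val + 1 : ℕ) : ZMod m) := by simp
  rcases Nat.lt_or_ge (j.val + 1) m with h | h
  · left
    rw [← hs, normalAngle, hj, ZMod.val_natCast, Nat.mod_eq_of_lt h]
  · right
    have hm : j.val + 1 = m := le_antisymm (ZMod.val_lt j) h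
    rw [← hs, hj, hm, ZMod.sum_range_natCast, hsum]
    simp [normalAngle]

theorem cos_normalAngle_add_one (m : ℕ) [NeZero m] (α : ZMod m → ℝ)
    (hsum : ∑ j, α j = 2 * Real.pi) (j : ZMod m) :
    Real.cos (normalAngle m α (j + 1)) = Real.cos (normalAngle m α j + α j) := by
  rcases normalAngle_add_one m α hsum j with h | h <;> simp [h]

theorem sin_normalAngle_add_one (m : ℕ) [NeZero m] (α : ZMod m → ℝ)
    (hsum : ∑ j, α j = 2 * Real.pi) (j : ZMod m) :
    Real.sin (normalAngle m α (j + 1)) = Real.sin (normalAngle m α j + α j) := by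
  rcases normalAngle_add_one m α hsum j with h | h <;> simp [h]

/-- The variation of support numbers induced by a parallel translation. -/
noncomputable def translationVariation (m : ℕ) (α : ZMod m → ℝ) :
    ℝ × ℝ →ₗ[ℝ] (ZMod m → ℝ) where
  toFun a j := a.1 * Real.cos (normalAngle m α j) + a.2 * Real.sin (normalAngle m α j)
  map_add' a b := by ext j; simp; ring
  map_smul' c a := by ext j; simp; ring

theorem translationVariation_apply (m : ℕ) (α : ZMod m → ℝ) (a : ℝ × ℝ) (j : ZMod m) :
    translationVariation m α a j =
      a.1 * Real.cos (normalAngle m α j) + a.2 * Real.sin (normalAngle m α j) := rfl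

theorem translationVariation_zero (m : ℕ) (α : ZMod m → ℝ) (a : ℝ × ℝ) :
    translationVariation m α a 0 = a.1 := by
  simp [translationVariation_apply, normalAngle]

theorem translationVariation_one (m : ℕ) [NeZero m] (α : ZMod m → ℝ)
    (hsum : ∑ j, α j = 2 * Real.pi) (a : ℝ × ℝ) :
    translationVariation m α a 1 = a.1 * Real.cos (α 0) + a.2 * Real.sin (α 0) := by
  have h1 := cos_normalAngle_add_one m α hsum 0
  have h2 := sin_normalAngle_add_one m α hsum 0
  have h0 : normalAngle m α 0 = 0 := by simp [normalAngle]
  rw [zero_add, h0, zero_add] at h1 h2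
  rw [translationVariation_apply, h1, h2]

theorem polygonHessian_mulVec_translationVariation (m : ℕ) [NeZero m] (hm : 3 ≤ m)
    (α : ZMod m → ℝ) (hα : ∀ j, Real.sin (α j) ≠ 0)
    (hsum : ∑ j, α j = 2 * Real.pi) (a : ℝ × ℝ) :
    (polygonHessian m α).mulVec (translationVariation m α a) = 0 := by
  ext j
  obtain ⟨k, rfl⟩ : ∃ k, j = k + 1 := ⟨j - 1, by ring⟩
  have hk := hα k
  have hj := hα (k + 1)
  rw [polygonHessian_mulVec_apply m hm]
  simp only [translationVariation_apply, add_sub_cancel_right, Pi.zero_apply,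
    cos_normalAngle_add_one m α hsum (k + 1), sin_normalAngle_add_one m α hsum (k + 1),
    Real.cos_add (normalAngle m α (k + 1)), Real.sin_add (normalAngle m α (k + 1)),
    cos_normalAngle_add_one m α hsum k, sin_normalAngle_add_one m α hsum k,
    Real.cos_add, Real.sin_add, Real.cot_eq_cos_div_sin]
  have hsq := Real.sin_sq_add_cos_sq (α k)
  generalize Real.sin (α k) = s at *
  generalize Real.cos (α k) = c at *
  generalize Real.sin (normalAngle m α k) = S at *
  generalize Real.cos (normalAngle m α k) = C at *
  field_simp
  linear_combination (-(Real.sin (α (k + 1)) * (a.1 * C + a.2 * S))) * hsq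

/-- A kernel vector is determined by two consecutive entries. -/
theorem eq_zero_of_polygonHessian_mulVec_eq_zero (m : ℕ) [NeZero m] (hm : 3 ≤ m)
    (α : ZMod m → ℝ) (hα : ∀ j, Real.sin (α j) ≠ 0) (v : ZMod m → ℝ)
    (hv : (polygonHessian m α).mulVec v = 0) (h0 : v 0 = 0) (h1 : v 1 = 0) : v = 0 := by
  have key : ∀ n : ℕ, v n = 0 ∧ v ((n : ZMod m) + 1) = 0 := by
    intro n
    induction n with
    | zero => simpa using ⟨h0, h1⟩
    | succ n ih =>
      push_cast
      refine ⟨ih.2, ?_⟩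
      have h := congrFun hv ((n : ZMod m) + 1)
      rw [polygonHessian_mulVec_apply m hm, add_sub_cancel_right, ih.1, ih.2] at h
      simpa [hα] using h
  ext j
  simpa using (key j.val).1

theorem range_translationVariation (m : ℕ) [NeZero m] (hm : 3 ≤ m)
    (α : ZMod m → ℝ) (hα : ∀ j, Real.sin (α j) ≠ 0) (hsum : ∑ j, α j = 2 * Real.pi) :
    LinearMap.range (translationVariation m α) =
      LinearMap.ker (polygonHessian m α).mulVecLin := by
  ext u
  rw [LinearMap.mem_range, LinearMap.mem_ker, Matrix.mulVecLin_apply]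
  constructor
  · rintro ⟨a, rfl⟩
    exact polygonHessian_mulVec_translationVariation m hm α hα hsum a
  · intro hu
    refine ⟨(u 0, (u 1 - u 0 * Real.cos (α 0)) / Real.sin (α 0)), ?_⟩
    symm
    rw [← sub_eq_zero]
    apply eq_zero_of_polygonHessian_mulVec_eq_zero m hm α hα
    · rw [Matrix.mulVec_sub, hu, polygonHessian_mulVec_translationVariation m hm α hα hsum,
        sub_zero]
    · simp [translationVariation_zero]
    · simp [translationVariation_one m α hsum, hα]

theorem translationVariation_injective (m : ℕ) [NeZero m]
    (α : ZMod m → ℝ) (hα : Real.sin (α 0) ≠ 0) (hsum : ∑ j, α j = 2 * Real.pi) :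
    Function.Injective (translationVariation m α) := by
  rw [injective_iff_map_eq_zero]
  intro a ha
  have h0 := congrFun ha 0
  have h1 := congrFun ha 1
  rw [translationVariation_zero] at h0
  rw [translationVariation_one m α hsum, h0] at h1
  ext
  · exact h0
  · simpa [hα] using h1

end PolygonHessian

/-- The kernel of the area Hessian of a convex `m`-gon with fixed edge directions
consists exactly of the variations of support numbers induced by parallel translations,
and is therefore 2-dimensional. Here `θⱼ = α₀ + … + α_{j−1}` and the `j`-th outer edge
normal is `μⱼ = (cos θⱼ, sin θⱼ)`. -/
theorem polygonHessian_kernel (m : ℕ) [NeZero m] (hm : 3 ≤ m)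
    (α : ZMod m → ℝ) (hα : ∀ j, 0 < α j ∧ α j < Real.pi)
    (hsum : ∑ j, α j = 2 * Real.pi) :
    (∀ u : ZMod m → ℝ,
      (polygonHessian m α).mulVec u = 0 ↔
        ∃ a : ℝ × ℝ, ∀ j : ℕ, j < m →
          u (j : ZMod m) =
            a.1 * Real.cos (∑ i ∈ Finset.range j, α (i : ZMod m)) +
            a.2 * Real.sin (∑ i ∈ Finset.range j, α (i : ZMod m))) ∧
    Module.finrank ℝ (LinearMap.ker (polygonHessian m α).mulVecLin) = 2 := by
  have hs : ∀ j, Real.sin (α j) ≠ 0 := fun j =>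
    (Real.sin_pos_of_pos_of_lt_pi (hα j).1 (hα j).2).ne'
  have hr := range_translationVariation m hm α hs hsum
  refine ⟨fun u => ?_, ?_⟩
  · rw [← Matrix.mulVecLin_apply, ← LinearMap.mem_ker, ← hr, LinearMap.mem_range]
    refine exists_congr fun a => ⟨?_, fun h => ?_⟩
    · rintro rfl j hj
      rw [translationVariation_apply, normalAngle, ZMod.val_natCast, Nat.mod_eq_of_lt hj]
    · ext j
      have hj := h j.val (ZMod.val_lt j)
      rw [ZMod.natCast_zmod_val] at hj
      rw [hj, translationVariation_apply, normalAngle]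
  · rw [← hr, LinearMap.finrank_range_of_inj
      (translationVariation_injective m α (hs 0) hsum)]
    simp
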